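/- Let I = (S,A,α,c,c_h,P̲,P̄,h) be an IMDP, and let V̄*_k be defined by V̄*_h := c_h and the backward recursion V̄*_k(s) := min_{π_k ∈ P^{|A|}} max_{(p^a)_{a∈A}, p^a ∈ P_s^a} [∑_{a∈A} π_k^a·c(s,a) + Φ(∑_{a∈A} π_k^a·p^a, V̄*_{k+1})]. Define the adversary ξ* by choosing, for each k, s, a, ξ*_k^a(s) ∈ argmax_{p ∈ P_s^a} [c(s,a) + Φ(p, V̄*_{k+1})], and the policy π* by choosing π*_k(s) ∈ argmin_{π_k ∈ P^{|A|}} [∑_{a∈A} π_k^a·c(s,a) + Φ(∑_{a∈A} π_k^a·ξ*_k^a(s), V̄*_{k+1})]. Then the pair (π*, ξ*) realizes the robust optimal value exactly: J^{π*,ξ*} + H(I^{π*,ξ*}) = min_{π∈Π} max_{ξ∈Ξ} (J^{π,ξ} + H(I^{π,ξ})), so the upper bound computed by the value iteration is tight. -/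

import Mathlib

open Finset

/-- The probability simplex over a finite type `T`. -/
def Simplex (T : Type) [Fintype T] : Set (T → ℝ) :=
  {p | (∀ t, 0 ≤ p t ∧ p t ≤ 1) ∧ ∑ t, p t = 1}

/-- `Φ(p,V) = -∑_q p_q log₂ p_q + ∑_q p_q V_q` (with `0·log₂ 0 = 0`,
which holds automatically since `Real.logb 2 0 = 0`). -/
noncomputable def Phi {S : Type} [Fintype S] (p V : S → ℝ) : ℝ :=
  (-∑ q, p q * Real.logb 2 (p q)) + ∑ q, p q * V q

/-- The set `P_s^a` of feasible transition distributions for state `s` and action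
`a`, given interval bounds `P̲ = Plo` and `P̄ = Pup`. -/
def Feas {S A : Type} [Fintype S] (Plo Pup : S → A → S → ℝ) (s : S) (a : A) :
    Set (S → ℝ) :=
  {p | p ∈ Simplex S ∧ ∀ q, Plo s a q ≤ p q ∧ p q ≤ Pup s a q}

/-- `π` is a (Markov) policy for horizon `h`: `π k s ∈ P^{|A|}` for every `k < h`. -/
def IsPolicy {S A : Type} [Fintype A] (h : ℕ) (π : ℕ → S → A → ℝ) : Prop :=
  ∀ k, k < h → ∀ s, π k s ∈ Simplex A

/-- `ξ` is a (Markov) adversary for horizon `h`: `ξ k s a ∈ P_s^a` for every `k < h`. -/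
def IsAdversary {S A : Type} [Fintype S] (h : ℕ) (Plo Pup : S → A → S → ℝ)
    (ξ : ℕ → S → A → S → ℝ) : Prop :=
  ∀ k, k < h → ∀ s a, ξ k s a ∈ Feas Plo Pup s a

/-- The path probability mass function on `S^{h+1}` induced by policy `π` and
adversary `ξ`: `p(s₀,…,s_h) = α(s₀) · ∏_{k=0}^{h-1} p_k^{s_k}(s_{k+1})` where
`p_k^s = ∑_a π_k^a(s)·ξ_k^a(s)`. -/
noncomputable def pathProb {S A : Type} [Fintype S] [Fintype A] (h : ℕ) (α : S → ℝ)
    (π : ℕ → S → A → ℝ) (ξ : ℕ → S → A → S → ℝ) (path : Fin (h + 1) → S) : ℝ :=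
  α (path 0) *
    ∏ k : Fin h, ∑ a, π k.1 (path k.castSucc) a * ξ k.1 (path k.castSucc) a (path k.succ)

/-- The expected cumulative cost `J^{π,ξ}`. -/
noncomputable def cumCost {S A : Type} [Fintype S] [Fintype A] (h : ℕ) (α : S → ℝ)
    (c : S → A → ℝ) (ch : S → ℝ)
    (π : ℕ → S → A → ℝ) (ξ : ℕ → S → A → S → ℝ) : ℝ :=
  ∑ path : Fin (h + 1) → S,
    pathProb h α π ξ path *
      ((∑ k : Fin h, ∑ a, π k.1 (path k.castSucc) a * c (path k.castSucc) a) +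
        ch (path (Fin.last h)))

/-- The path entropy `H(I^{π,ξ})` (with `0·log₂ 0 = 0`). -/
noncomputable def pathEnt {S A : Type} [Fintype S] [Fintype A] (h : ℕ) (α : S → ℝ)
    (π : ℕ → S → A → ℝ) (ξ : ℕ → S → A → S → ℝ) : ℝ :=
  -∑ path : Fin (h + 1) → S,
    pathProb h α π ξ path * Real.logb 2 (pathProb h α π ξ path)

lemma neg_mul_logb_eq_negMulLog_div (x : ℝ) :
    -(x * Real.logb 2 x) = Real.negMulLog x / Real.log 2 := by
  simp only [Real.logb, Real.negMulLog]
  ring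

lemma neg_mul_logb_le {x : ℝ} (hx : 0 ≤ x) : -(x * Real.logb 2 x) ≤ 1 / Real.log 2 := by
  rw [neg_mul_logb_eq_negMulLog_div]
  refine div_le_div_of_nonneg_right ?_ (Real.log_nonneg one_le_two)
  exact (Real.negMulLog_le_one_sub_self hx).trans (by linarith)

lemma mul_logb_mul (x y : ℝ) :
    x * y * Real.logb 2 (x * y) = y * (x * Real.logb 2 x) + x * (y * Real.logb 2 y) := by
  rcases eq_or_ne x 0 with rfl | hx
  · simp
  rcases eq_or_ne y 0 with rfl | hy
  · simp
  rw [Real.logb_mul hx hy]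
  ring

lemma sum_mul_mem_Simplex {S A : Type} [Fintype S] [Fintype A] {w : A → ℝ} {p : A → S → ℝ}
    (hw : w ∈ Simplex A) (hp : ∀ a, p a ∈ Simplex S) :
    (fun q => ∑ a, w a * p a q) ∈ Simplex S := by
  refine ⟨fun q => ⟨sum_nonneg fun a _ => mul_nonneg (hw.1 a).1 ((hp a).1 q).1, ?_⟩, ?_⟩
  · calc ∑ a, w a * p a q ≤ ∑ a, w a :=
          sum_le_sum fun a _ => mul_le_of_le_one_right (hw.1 a).1 ((hp a).1 q).2
      _ = 1 := hw.2
  · rw [sum_comm]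
    simp_rw [← mul_sum, (hp _).2, mul_one]
    exact hw.2

lemma single_mem_Simplex {A : Type} [Fintype A] [DecidableEq A] (a : A) :
    (Pi.single a 1 : A → ℝ) ∈ Simplex A := by
  refine ⟨fun t => ?_, by simp⟩
  rcases eq_or_ne t a with rfl | ht <;> simp [*]

lemma le_sum_mul_of_mem_Simplex {A : Type} [Fintype A] {w f : A → ℝ} {m : ℝ}
    (hw : w ∈ Simplex A) (hf : ∀ a, m ≤ f a) : m ≤ ∑ a, w a * f a :=
  calc m = ∑ a, w a * m := by rw [← sum_mul, hw.2, one_mul]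
    _ ≤ ∑ a, w a * f a := sum_le_sum fun a _ => mul_le_mul_of_nonneg_left (hf a) (hw.1 a).1

lemma Phi_le_of_mem_Simplex {S : Type} [Fintype S] {p : S → ℝ} (hp : p ∈ Simplex S)
    (V : S → ℝ) : Phi p V ≤ ∑ q, (1 / Real.log 2 + |V q|) := by
  rw [Phi, ← sum_neg_distrib, ← sum_add_distrib]
  refine sum_le_sum fun q _ => add_le_add (neg_mul_logb_le (hp.1 q).1) ?_
  calc p q * V q ≤ p q * |V q| := mul_le_mul_of_nonneg_left (le_abs_self _) (hp.1 q).1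
    _ ≤ |V q| := mul_le_of_le_one_left (abs_nonneg _) (hp.1 q).2

/-- `Phi` is concave in its first argument. -/
lemma sum_mul_Phi_le {S A : Type} [Fintype S] [Fintype A] {w : A → ℝ} {p : A → S → ℝ}
    (hw : w ∈ Simplex A) (hp : ∀ a q, 0 ≤ p a q) (V : S → ℝ) :
    ∑ a, w a * Phi (p a) V ≤ Phi (fun q => ∑ a, w a * p a q) V := by
  simp only [Phi, ← sum_neg_distrib, ← sum_add_distrib, mul_sum]
  rw [sum_comm]
  refine sum_le_sum fun q _ => ?_
  simp only [mul_add, sum_add_distrib, neg_mul_logb_eq_negMulLog_div]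
  refine add_le_add ?_ (le_of_eq ?_)
  · simp only [← mul_div_assoc, ← sum_div]
    refine div_le_div_of_nonneg_right ?_ (Real.log_nonneg one_le_two)
    exact Real.concaveOn_negMulLog.le_map_sum (fun a _ => (hw.1 a).1) hw.2 (fun a _ => hp a q)
  · rw [sum_mul]
    exact sum_congr rfl fun a _ => by ring

section Path

variable {S A : Type} [Fintype S] [Fintype A] {h : ℕ} {α : S → ℝ} {c : S → A → ℝ}
  {π : ℕ → S → A → ℝ} {ξ : ℕ → S → A → S → ℝ}

lemma pathProb_nonneg (hα : ∀ s, 0 ≤ α s) (hπ : IsPolicy h π)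
    (hξ : ∀ k, k < h → ∀ s a, ξ k s a ∈ Simplex S) (path : Fin (h + 1) → S) :
    0 ≤ pathProb h α π ξ path :=
  mul_nonneg (hα _) (prod_nonneg fun k _ =>
    ((sum_mul_mem_Simplex (hπ k.1 k.2 _) (hξ k.1 k.2 _)).1 _).1)

lemma pathProb_le_one (hα : α ∈ Simplex S) (hπ : IsPolicy h π)
    (hξ : ∀ k, k < h → ∀ s a, ξ k s a ∈ Simplex S) (path : Fin (h + 1) → S) :
    pathProb h α π ξ path ≤ 1 := by
  have hp := fun k : Fin h =>
    (sum_mul_mem_Simplex (hπ k.1 k.2 (path k.castSucc))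
      (hξ k.1 k.2 (path k.castSucc))).1 (path k.succ)
  exact mul_le_one₀ (hα.1 _).2 (prod_nonneg fun k _ => (hp k).1)
    (prod_le_one (fun k _ => (hp k).1) fun k _ => (hp k).2)

lemma pathProb_snoc (path : Fin (h + 1) → S) (q : S) :
    pathProb (h + 1) α π ξ (Fin.snoc path q : Fin (h + 2) → S) =
      pathProb h α π ξ path *
        ∑ a, π h (path (Fin.last h)) a * ξ h (path (Fin.last h)) a q := by
  have h0 : (Fin.snoc path q : Fin (h + 2) → S) 0 = path 0 := by
    rw [← Fin.castSucc_zero, Fin.snoc_castSucc (α := fun _ => S)]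
  simp only [pathProb, h0, Fin.prod_univ_castSucc, Fin.succ_last, Fin.snoc_last,
    Fin.snoc_castSucc (α := fun _ => S), Fin.succ_castSucc, Fin.val_castSucc, Fin.val_last,
    mul_assoc]

lemma sum_path_succ (f : (Fin (h + 2) → S) → ℝ) :
    ∑ path, f path =
      ∑ path : Fin (h + 1) → S, ∑ q, f (Fin.snoc path q : Fin (h + 2) → S) := by
  rw [← (Fin.snocEquiv fun _ : Fin (h + 2) => S).sum_comp, Fintype.sum_prod_type_right]
  rfl

lemma cumCost_add_pathEnt_zero (ch : S → ℝ) :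
    cumCost 0 α c ch π ξ + pathEnt 0 α π ξ = Phi α ch := by
  simp only [cumCost, pathEnt, pathProb, Phi, univ_eq_empty, prod_empty, sum_empty, mul_one,
    zero_add]
  rw [add_comm, ← (Equiv.funUnique (Fin 1) S).symm.sum_comp,
    ← (Equiv.funUnique (Fin 1) S).symm.sum_comp]
  simp

/-- The last stage can be absorbed into the terminal cost. -/
lemma cumCost_add_pathEnt_succ (ch : S → ℝ)
    (hp : ∀ s, ∑ q, ∑ a, π h s a * ξ h s a q = 1) :
    cumCost (h + 1) α c ch π ξ + pathEnt (h + 1) α π ξ =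
      cumCost h α c (fun s => (∑ a, π h s a * c s a) +
        Phi (fun q => ∑ a, π h s a * ξ h s a q) ch) π ξ + pathEnt h α π ξ := by
  simp only [cumCost, pathEnt, sum_path_succ, ← sum_neg_distrib, ← sum_add_distrib]
  refine sum_congr rfl fun path _ => ?_
  simp only [pathProb_snoc, mul_logb_mul, Fin.sum_univ_castSucc (n := h), Fin.snoc_last,
    Fin.snoc_castSucc (α := fun _ => S), Fin.val_castSucc, Fin.val_last, Phi]
  have hp' := hp (path (Fin.last h))
  simp only [mul_add, neg_add, sum_add_distrib, sum_neg_distrib, ← sum_mul, ← mul_sum, hp',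
    mul_assoc]
  ring

/-- `cumCost` is monotone in the terminal cost. -/
lemma cumCost_mono (hα : ∀ s, 0 ≤ α s) (hπ : IsPolicy h π)
    (hξ : ∀ k, k < h → ∀ s a, ξ k s a ∈ Simplex S) {ch ch' : S → ℝ} (hch : ∀ s, ch s ≤ ch' s) :
    cumCost h α c ch π ξ ≤ cumCost h α c ch' π ξ :=
  sum_le_sum fun path _ => mul_le_mul_of_nonneg_left (add_le_add_right (hch _) _)
    (pathProb_nonneg hα hπ hξ path)

lemma Phi_le_cumCost_add_pathEnt (hα : ∀ s, 0 ≤ α s) (hπ : IsPolicy h π)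
    (hξ : ∀ k, k < h → ∀ s a, ξ k s a ∈ Simplex S) {V : ℕ → S → ℝ}
    (hV : ∀ k, k < h → ∀ s, V k s ≤ (∑ a, π k s a * c s a) +
      Phi (fun q => ∑ a, π k s a * ξ k s a q) (V (k + 1))) :
    Phi α (V 0) ≤ cumCost h α c (V h) π ξ + pathEnt h α π ξ := by
  induction h with
  | zero => rw [cumCost_add_pathEnt_zero]
  | succ h ih =>
    have hπ' : IsPolicy h π := fun k hk => hπ k (hk.trans h.lt_succ_self)
    have hξ' : ∀ k, k < h → ∀ s a, ξ k s a ∈ Simplex S :=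
      fun k hk => hξ k (hk.trans h.lt_succ_self)
    rw [cumCost_add_pathEnt_succ _ fun s =>
      (sum_mul_mem_Simplex (hπ h h.lt_succ_self s) (hξ h h.lt_succ_self s)).2]
    refine (ih hπ' hξ' fun k hk => hV k (hk.trans h.lt_succ_self)).trans ?_
    gcongr
    exact cumCost_mono hα hπ' hξ' (hV h h.lt_succ_self)

lemma cumCost_add_pathEnt_le_Phi (hα : ∀ s, 0 ≤ α s) (hπ : IsPolicy h π)
    (hξ : ∀ k, k < h → ∀ s a, ξ k s a ∈ Simplex S) {V : ℕ → S → ℝ}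
    (hV : ∀ k, k < h → ∀ s, (∑ a, π k s a * c s a) +
      Phi (fun q => ∑ a, π k s a * ξ k s a q) (V (k + 1)) ≤ V k s) :
    cumCost h α c (V h) π ξ + pathEnt h α π ξ ≤ Phi α (V 0) := by
  induction h with
  | zero => rw [cumCost_add_pathEnt_zero]
  | succ h ih =>
    have hπ' : IsPolicy h π := fun k hk => hπ k (hk.trans h.lt_succ_self)
    have hξ' : ∀ k, k < h → ∀ s a, ξ k s a ∈ Simplex S :=
      fun k hk => hξ k (hk.trans h.lt_succ_self)
    rw [cumCost_add_pathEnt_succ _ fun s =>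
      (sum_mul_mem_Simplex (hπ h h.lt_succ_self s) (hξ h h.lt_succ_self s)).2]
    refine le_trans ?_ (ih hπ' hξ' fun k hk => hV k (hk.trans h.lt_succ_self))
    gcongr
    exact cumCost_mono hα hπ' hξ' (hV h h.lt_succ_self)

lemma bddAbove_cumCost_add_pathEnt (hα : α ∈ Simplex S) (hπ : IsPolicy h π)
    (Plo Pup : S → A → S → ℝ) (ch : S → ℝ) :
    BddAbove {y | ∃ ξ, IsAdversary h Plo Pup ξ ∧
      y = cumCost h α c ch π ξ + pathEnt h α π ξ} := by
  refine ⟨∑ path : Fin (h + 1) → S,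
    (|(∑ k : Fin h, ∑ a, π k.1 (path k.castSucc) a * c (path k.castSucc) a) +
      ch (path (Fin.last h))| + 1 / Real.log 2), ?_⟩
  rintro y ⟨ξ, hξ, rfl⟩
  have hξ' : ∀ k, k < h → ∀ s a, ξ k s a ∈ Simplex S := fun k hk s a => (hξ k hk s a).1
  have hp := pathProb_nonneg (fun s => (hα.1 s).1) hπ hξ'
  rw [cumCost, pathEnt, ← sum_neg_distrib, ← sum_add_distrib]
  refine sum_le_sum fun path _ => add_le_add ?_ (neg_mul_logb_le (hp path))
  exact (mul_le_mul_of_nonneg_left (le_abs_self _) (hp path)).trans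
    (mul_le_of_le_one_left (abs_nonneg _) (pathProb_le_one hα hπ hξ' path))

end Path

section Stage

variable {S A : Type} [Fintype S] [Fintype A] {c : S → A → ℝ} {Plo Pup : S → A → S → ℝ} {s : S}
  {V : S → ℝ} {ξ : A → S → ℝ}

/-- Against a fixed adversary, no randomized action improves on the best deterministic one. -/
lemma le_stage_of_forall_le {w : A → ℝ} {m : ℝ} (hw : w ∈ Simplex A) (hξ : ∀ a q, 0 ≤ ξ a q)
    (hm : ∀ a, m ≤ c s a + Phi (ξ a) V) :
    m ≤ (∑ a, w a * c s a) + Phi (fun q => ∑ a, w a * ξ a q) V := by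
  refine (le_sum_mul_of_mem_Simplex hw hm).trans ?_
  simp only [mul_add, sum_add_distrib]
  gcongr
  exact sum_mul_Phi_le hw hξ V

lemma stage_single [DecidableEq A] (a : A) (p : A → S → ℝ) :
    (∑ b, (Pi.single a 1 : A → ℝ) b * c s b) +
      Phi (fun q => ∑ b, (Pi.single a 1 : A → ℝ) b * p b q) V = c s a + Phi (p a) V := by
  simp [Pi.single_apply]

/-- The one-stage min-max value is attained by a deterministic action. -/
lemma isLeast_stage {a : A}
    (hξ : ∀ b, ξ b ∈ Feas Plo Pup s b ∧
      ∀ p ∈ Feas Plo Pup s b, c s b + Phi p V ≤ c s b + Phi (ξ b) V)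
    (ha : ∀ b, c s a + Phi (ξ a) V ≤ c s b + Phi (ξ b) V) :
    IsLeast {x | ∃ w ∈ Simplex A, x =
        sSup {y | ∃ p : A → S → ℝ, (∀ b, p b ∈ Feas Plo Pup s b) ∧
          y = (∑ b, w b * c s b) + Phi (fun q => ∑ b, w b * p b q) V}}
      (c s a + Phi (ξ a) V) := by
  classical
  constructor
  · refine ⟨Pi.single a 1, single_mem_Simplex a, Eq.symm (IsGreatest.csSup_eq ⟨?_, ?_⟩)⟩
    · exact ⟨ξ, fun b => (hξ b).1, (stage_single a ξ).symm⟩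
    · rintro y ⟨p, hp, rfl⟩
      rw [stage_single]
      exact (hξ a).2 _ (hp a)
  · rintro x ⟨w, hw, rfl⟩
    refine (le_stage_of_forall_le hw (fun b q => ((hξ b).1.1.1 q).1) ha).trans
      (le_csSup ⟨(∑ b, w b * c s b) + ∑ q, (1 / Real.log 2 + |V q|), ?_⟩
        ⟨ξ, fun b => (hξ b).1, rfl⟩)
    rintro y ⟨p, hp, rfl⟩
    gcongr
    exact Phi_le_of_mem_Simplex (sum_mul_mem_Simplex hw fun b => (hp b).1) V

end Stage

/-- Tightness of the value-iteration bound: for an IMDP with value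
functions `V̄*` defined by the backward min–max recursion, if `ξ*` is obtained by
pointwise maximization over `P_s^a` of `c(s,a) + Φ(p, V̄*_{k+1})`, and `π*` by
pointwise minimization over `P^{|A|}` of
`∑_a π^a c(s,a) + Φ(∑_a π^a ξ*_k^a(s), V̄*_{k+1})`, then the pair `(π*,ξ*)` realizes
the robust optimal value exactly:
`J^{π*,ξ*} + H(I^{π*,ξ*}) = min_{π∈Π} max_{ξ∈Ξ} (J^{π,ξ} + H(I^{π,ξ}))`. -/
theorem optimal_policy_adversary_realize_bound
    {S A : Type} [Fintype S] [Fintype A] [Nonempty S] [Nonempty A]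
    (h : ℕ) (α : S → ℝ) (c : S → A → ℝ) (ch : S → ℝ)
    (Plo Pup : S → A → S → ℝ)
    (hα : α ∈ Simplex S)
    (hbounds : ∀ s a q, 0 ≤ Plo s a q ∧ Plo s a q ≤ Pup s a q ∧ Pup s a q ≤ 1)
    (hsums : ∀ s a, ∑ q, Plo s a q ≤ 1 ∧ 1 ≤ ∑ q, Pup s a q)
    (hfeas : ∀ s a, (Feas Plo Pup s a).Nonempty)
    -- the value-iteration recursion
    (V : ℕ → S → ℝ)
    (hVh : ∀ s, V h s = ch s)
    (hV : ∀ k, k < h → ∀ s,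
      V k s = sInf {x | ∃ πk ∈ Simplex A, x =
        sSup {y | ∃ pc : A → S → ℝ, (∀ a, pc a ∈ Feas Plo Pup s a) ∧
          y = (∑ a, πk a * c s a) +
            Phi (fun q => ∑ a, πk a * pc a q) (V (k + 1))}})
    -- ξ* : worst-case adversary, argmax of c(s,a) + Φ(p, V̄*_{k+1}) over P_s^a
    (ξs : ℕ → S → A → S → ℝ)
    (hξs : ∀ k, k < h → ∀ s a,
      ξs k s a ∈ Feas Plo Pup s a ∧
        ∀ p ∈ Feas Plo Pup s a,
          c s a + Phi p (V (k + 1)) ≤ c s a + Phi (ξs k s a) (V (k + 1)))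
    -- π* : optimal policy, argmin over the simplex given ξ*
    (πs : ℕ → S → A → ℝ)
    (hπs : ∀ k, k < h → ∀ s,
      πs k s ∈ Simplex A ∧
        ∀ πk ∈ Simplex A,
          (∑ a, πs k s a * c s a) +
              Phi (fun q => ∑ a, πs k s a * ξs k s a q) (V (k + 1)) ≤
            (∑ a, πk a * c s a) +
              Phi (fun q => ∑ a, πk a * ξs k s a q) (V (k + 1))) :
    -- (π*, ξ*) realizes the robust optimal value exactly
    cumCost h α c ch πs ξs + pathEnt h α πs ξs
      = sInf {x | ∃ π, IsPolicy h π ∧ x =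
          sSup {y | ∃ ξ, IsAdversary h Plo Pup ξ ∧
            y = cumCost h α c ch π ξ + pathEnt h α π ξ}} := by
  classical
  have hα0 : ∀ s, 0 ≤ α s := fun s => (hα.1 s).1
  obtain rfl : V h = ch := funext hVh
  choose d hd using fun k s => Finite.exists_min fun a => c s a + Phi (ξs k s a) (V (k + 1))
  have hVd : ∀ k, k < h → ∀ s, V k s = c s (d k s) + Phi (ξs k s (d k s)) (V (k + 1)) :=
    fun k hk s => (hV k hk s).trans (isLeast_stage (hξs k hk s) (hd k s)).csInf_eq
  have hξs_adv : IsAdversary h Plo Pup ξs := fun k hk s a => (hξs k hk s a).1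
  have hξs_simplex : ∀ k, k < h → ∀ s a, ξs k s a ∈ Simplex S :=
    fun k hk s a => (hξs_adv k hk s a).1
  have hπs_pol : IsPolicy h πs := fun k hk s => (hπs k hk s).1
  have hlower : ∀ π, IsPolicy h π →
      Phi α (V 0) ≤ cumCost h α c (V h) π ξs + pathEnt h α π ξs := fun π hπ =>
    Phi_le_cumCost_add_pathEnt hα0 hπ hξs_simplex fun k hk s =>
      le_stage_of_forall_le (hπ k hk s) (fun a q => ((hξs_simplex k hk s a).1 q).1)
        fun a => (hVd k hk s).trans_le (hd k s a)
  have hupper : cumCost h α c (V h) πs ξs + pathEnt h α πs ξs ≤ Phi α (V 0) :=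
    cumCost_add_pathEnt_le_Phi hα0 hπs_pol hξs_simplex fun k hk s =>
      ((hπs k hk s).2 _ (single_mem_Simplex (d k s))).trans
        ((stage_single _ _).trans (hVd k hk s).symm).le
  have hdet_pol : IsPolicy h fun k s => (Pi.single (d k s) 1 : A → ℝ) :=
    fun k _ s => single_mem_Simplex (d k s)
  rw [hupper.antisymm (hlower πs hπs_pol)]
  symm
  refine IsLeast.csInf_eq ⟨⟨_, hdet_pol, le_antisymm ?_ (csSup_le ⟨_, ξs, hξs_adv, rfl⟩ ?_)⟩, ?_⟩
  · exact (hlower _ hdet_pol).trans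
      (le_csSup (bddAbove_cumCost_add_pathEnt hα hdet_pol Plo Pup _) ⟨ξs, hξs_adv, rfl⟩)
  · rintro y ⟨ξ, hξ, rfl⟩
    refine cumCost_add_pathEnt_le_Phi hα0 hdet_pol (fun k hk s a => (hξ k hk s a).1)
      fun k hk s => ?_
    rw [stage_single, hVd k hk s]
    exact (hξs k hk s _).2 _ (hξ k hk s _)
  · rintro x ⟨π, hπ, rfl⟩
    exact (hlower π hπ).trans
      (le_csSup (bddAbove_cumCost_add_pathEnt hα hπ Plo Pup _) ⟨ξs, hξs_adv, rfl⟩)
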